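/- Let α₀ ∈ (0,2), β > 0, and let F' : [α₀,2] → [0,∞) be continuous with F'(t+α₀ · p ... ) satisfying F'(tp + α₀)/F'(t + α₀) → p^β as t → 0⁺ for each p > 0, uniformly on compact subsets of (0,∞). Define g̃(n) = F'(α₀/log n + α₀) · (α₀/log n) · Γ(β+1). Then for every y with |y| ≥ δ > 0, (1/g̃(n)) ∫_{α₀}^{2} |y|^{-1-q} n^{1-q/α₀} F'(q) dq → |y|^{-1-α₀} as n → ∞, uniformly in |y| ≥ δ. -/

import Mathlib

open MeasureTheory Filter Set Real

lemma potter (c β : ℝ) (hc : 0 < c) (hβ : 0 < β) (F : ℝ → ℝ)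
    (hcont : ContinuousOn F (Icc 0 c)) (hnn : ∀ q ∈ Icc 0 c, 0 ≤ F q)
    (hpos : ∃ ε > 0, ∀ t ∈ Ioo (0:ℝ) ε, 0 < F t)
    (hreg : ∀ K : Set ℝ, K ⊆ Ioi 0 → IsCompact K →
      TendstoUniformlyOn (fun t p => F (t * p) / F t) (fun p => p ^ β)
        (nhdsWithin 0 (Ioi 0)) K) :
    ∃ C T : ℝ, 0 < C ∧ 0 < T ∧ ∀ t ∈ Ioc 0 T, 0 < F t ∧ ∀ p, 0 < p → t * p ≤ c →
      F (t * p) ≤ C * exp (p / 2) * F t := by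
  obtain ⟨ε, hε, hpos⟩ := hpos
  obtain ⟨k, hk⟩ : ∃ k : ℕ, (2:ℝ) ^ β + 1 ≤ 2 ^ k := by
    obtain ⟨k, hk⟩ := pow_unbounded_of_one_lt ((2:ℝ) ^ β + 1) (by norm_num : (1:ℝ) < 2)
    exact ⟨k, hk.le⟩
  have hhalf : ((1:ℝ)/2) ^ β < 1 := Real.rpow_lt_one (by norm_num) (by norm_num) hβ
  set η : ℝ := 1 - ((1:ℝ)/2) ^ β with hη
  have hη0 : 0 < η := by linarith
  have hη1 : η < 1 := by
    have : 0 < ((1:ℝ)/2) ^ β := by positivity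
    linarith
  have h1 := hreg (Icc (1/2) 2) (fun x hx => lt_of_lt_of_le (by norm_num) hx.1) isCompact_Icc
  rw [Metric.tendstoUniformlyOn_iff] at h1
  have h2 := h1 η hη0
  rw [eventually_nhdsWithin_iff, Metric.eventually_nhds_iff] at h2
  obtain ⟨T0, hT0, h2⟩ := h2
  obtain ⟨T, hT, hTT0, hTc, hTε⟩ : ∃ T > 0, T < T0 ∧ T < c ∧ T < ε := by
    refine ⟨min T0 (min c ε) / 2, ?_, ?_, ?_, ?_⟩
    · positivity
    all_goals
      have h0 : 0 < min T0 (min c ε) := by positivity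
      have a1 := min_le_left T0 (min c ε)
      have a2 := min_le_right T0 (min c ε)
      have a3 := min_le_left c ε
      have a4 := min_le_right c ε
      linarith
  have hFpos : ∀ t, 0 < t → t ≤ T → 0 < F t := fun t h h' => hpos t ⟨h, by linarith⟩
  have hstep : ∀ t, 0 < t → t ≤ T → ∀ p, 1/2 ≤ p → p ≤ 2 → F (t * p) ≤ 2 ^ k * F t := by
    intro t ht htT p hp hp'
    have := h2 (y := t) (by rw [Real.dist_eq, sub_zero, abs_of_pos ht]; linarith) ht p ⟨hp, hp'⟩
    rw [Real.dist_eq, abs_lt] at this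
    have h3 : p ^ β ≤ 2 ^ β := Real.rpow_le_rpow (by linarith) hp' hβ.le
    rw [← div_le_iff₀ (hFpos t ht htT)]
    linarith
  have hstep2 : ∀ t, 0 < t → t ≤ T → F (t / 2) ≤ F t := by
    intro t ht htT
    have := h2 (y := t) (by rw [Real.dist_eq, sub_zero, abs_of_pos ht]; linarith) ht (1/2)
      ⟨le_rfl, by norm_num⟩
    rw [Real.dist_eq, abs_lt] at this
    have h3 : F (t * (1/2)) / F t ≤ 1 := by linarith
    rw [div_le_one (hFpos t ht htT)] at h3
    rwa [show t * (1/2) = t / 2 by ring] at h3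
  have hup : ∀ m : ℕ, ∀ t, 0 < t → ∀ p, 1 ≤ p → p ≤ 2 ^ m → t * p ≤ T →
      F (t * p) ≤ 2 ^ k * p ^ k * F t := by
    intro m
    have base : ∀ t, 0 < t → ∀ p, 1 ≤ p → p ≤ 2 → t * p ≤ T →
      F (t * p) ≤ 2 ^ k * p ^ k * F t := by
      intro t ht p hp hp2 htp
      have htT : t ≤ T := by nlinarith
      have h3 := hstep t ht htT p (by linarith) hp2
      have h4 := hFpos t ht htT
      have h5 : 1 ≤ p ^ k := one_le_pow₀ hp
      calc F (t * p) ≤ 2 ^ k * F t := h3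
        _ = 2 ^ k * 1 * F t := by ring
        _ ≤ _ := by gcongr
    induction m with
    | zero =>
      intro t ht p hp hp2 htp
      exact base t ht p hp (by norm_num at hp2; linarith) htp
    | succ m ih =>
      intro t ht p hp hp2 htp
      by_cases h : p ≤ 2
      · exact base t ht p hp h htp
      push Not at h
      have h3 := ih t ht (p/2) (by linarith) (by rw [pow_succ] at hp2; linarith) (by nlinarith)
      have h4 := hstep (t * (p/2)) (by positivity) (by nlinarith) 2 (by norm_num) le_rfl
      rw [show t * (p/2) * 2 = t * p by ring] at h4
      calc F (t * p) ≤ _ := h4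
        _ ≤ 2 ^ k * (2 ^ k * (p/2) ^ k * F t) := by gcongr
        _ = _ := by rw [div_pow]; field_simp
  have hup' : ∀ t, 0 < t → ∀ p, 1 ≤ p → t * p ≤ T → F (t * p) ≤ 2 ^ k * p ^ k * F t := by
    intro t ht p hp htp
    obtain ⟨m, hm⟩ := pow_unbounded_of_one_lt p (by norm_num : (1:ℝ) < 2)
    exact hup m t ht p hp hm.le htp
  have hlow : ∀ m : ℕ, ∀ t, 0 < t → t ≤ T → ∀ p, 0 < p → p ≤ 1 → 1 ≤ p * 2 ^ m →
      F (t * p) ≤ 2 ^ k * F t := by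
    intro m
    induction m with
    | zero =>
      intro t ht htT p hp hp1 hpm
      exact hstep t ht htT p (by norm_num at hpm; linarith) (by linarith)
    | succ m ih =>
      intro t ht htT p hp hp1 hpm
      by_cases h : 1/2 ≤ p
      · exact hstep t ht htT p h (by linarith)
      push Not at h
      have h3 := ih t ht htT (2 * p) (by linarith) (by linarith) (by rw [pow_succ] at hpm; linarith)
      have h4 := hstep2 (t * (2 * p)) (by positivity) (by nlinarith)
      rw [show t * (2 * p) / 2 = t * p by ring] at h4
      linarith
  have hlow' : ∀ t, 0 < t → t ≤ T → ∀ p, 0 < p → p ≤ 1 → F (t * p) ≤ 2 ^ k * F t := by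
    intro t ht htT p hp hp1
    obtain ⟨m, hm⟩ := pow_unbounded_of_one_lt (1 / p) (by norm_num : (1:ℝ) < 2)
    refine hlow m t ht htT p hp hp1 ?_
    rw [div_lt_iff₀ hp] at hm
    linarith
  obtain ⟨M, hM⟩ := (isCompact_Icc.image_of_continuousOn hcont).bddAbove
  have hM' : ∀ q ∈ Icc 0 c, F q ≤ M := fun q hq => hM ⟨q, hq, rfl⟩
  have hFT := hFpos T hT le_rfl
  have hM0 : 0 < M := lt_of_lt_of_le hFT (hM' T ⟨hT.le, hTc.le⟩)
  have key : ∀ t, 0 < t → t ≤ T → ∀ p, 0 < p → t * p ≤ c →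
      F (t * p) ≤ 2 ^ k * (1 + M / F T) * (1 + p) ^ k * F t := by
    intro t ht htT p hp htp
    have hFt := hFpos t ht htT
    have hMF : 0 < M / F T := by positivity
    rcases le_or_gt (t * p) T with h | h
    · rcases le_or_gt p 1 with h1 | h1
      · calc F (t * p) ≤ 2 ^ k * F t := hlow' t ht htT p hp h1
          _ = 2 ^ k * 1 * 1 * F t := by ring
          _ ≤ _ := by
            have : 1 ≤ (1 + p) ^ k := one_le_pow₀ (by linarith)
            gcongr
            linarith
      · calc F (t * p) ≤ _ := hup' t ht p h1.le h
          _ = 2 ^ k * 1 * p ^ k * F t := by ring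
          _ ≤ _ := by
            gcongr
            · linarith
            · linarith
    · have h3 := hup' t ht (T / t) (by rwa [one_le_div ht]) (by field_simp; rfl)
      rw [show t * (T / t) = T by field_simp] at h3
      calc F (t * p) ≤ M := hM' _ ⟨by positivity, htp⟩
        _ = M / F T * F T := by field_simp
        _ ≤ M / F T * (2 ^ k * (T / t) ^ k * F t) := by gcongr
        _ = 2 ^ k * (M / F T) * (T / t) ^ k * F t := by ring
        _ ≤ _ := by
          gcongr
          · linarith
          · rw [div_le_iff₀ ht]; nlinarith
  refine ⟨2 ^ k * (1 + M / F T) * (k.factorial * 2 ^ k * exp (1/2)), T, by positivity, hT, ?_⟩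
  intro t ht
  have hFt := hFpos t ht.1 ht.2
  refine ⟨hFt, fun p hp htp => (key t ht.1 ht.2 p hp htp).trans ?_⟩
  have h5 := Real.pow_div_factorial_le_exp ((1 + p) / 2) (by positivity) k
  rw [div_le_iff₀ (by positivity), div_pow, div_le_iff₀ (by positivity), add_div, Real.exp_add] at h5
  calc _ ≤ 2 ^ k * (1 + M / F T) * (exp (1/2) * exp (p/2) * k.factorial * 2 ^ k) * F t := by
        have : 0 < M / F T := by positivity
        gcongr
    _ = _ := by ring

lemma lip (c a δ : ℝ) (ha : 1 ≤ a) (hδ : 0 < δ) :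
    ∃ L : ℝ, 0 < L ∧ ∀ r, δ ≤ r → ∀ u, 0 ≤ u → u ≤ c →
      |r ^ (-a - u) - r ^ (-a)| ≤ L * u := by
  refine ⟨2 + δ ^ (-a) * (1/δ) * (1 + δ ^ (-c)), by positivity, ?_⟩
  intro r hr u hu huc
  have hr0 : 0 < r := by linarith
  have hexp : ∀ x : ℝ, |exp x - 1| ≤ |x| * (1 + exp x) := by
    intro x
    have e1 := Real.add_one_le_exp x
    have e2 := Real.add_one_le_exp (-x)
    have e3 : exp x * exp (-x) = 1 := by rw [← Real.exp_add]; simp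
    have e4 := Real.exp_pos x
    rcases le_total 0 x with h | h
    · rw [abs_of_nonneg h, abs_of_nonneg (by linarith)]
      nlinarith
    · rw [abs_of_nonpos h, abs_of_nonpos (by have := Real.exp_le_one_iff.2 h; linarith)]
      nlinarith
  have h1 : r ^ (-a - u) - r ^ (-a) = r ^ (-a) * (exp (-(u * log r)) - 1) := by
    rw [sub_eq_add_neg (-a), Real.rpow_add hr0, Real.rpow_def_of_pos hr0 (-u)]
    ring_nf
  have h2 : exp (-(u * log r)) = r ^ (-u) := by
    rw [Real.rpow_def_of_pos hr0]; ring_nf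
  have h3 := hexp (-(u * log r))
  rw [h1, abs_mul, abs_of_pos (by positivity : 0 < r ^ (-a))]
  have h4 : r ^ (-a) * |exp (-(u * log r)) - 1| ≤ (r ^ (-a) * |log r| * (1 + r ^ (-u))) * u := by
    rw [h2] at h3 ⊢
    rw [abs_neg, abs_mul, abs_of_nonneg hu] at h3
    calc _ ≤ r ^ (-a) * (u * |log r| * (1 + r ^ (-u))) := by gcongr
      _ = _ := by ring
  refine h4.trans ?_
  gcongr
  rcases le_total 1 r with h | h
  · have k1 : r ^ (-a) ≤ r ^ (-1:ℝ) := Real.rpow_le_rpow_of_exponent_le h (by linarith)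
    have k2 : |log r| ≤ r := by
      rw [abs_of_nonneg (Real.log_nonneg h)]
      exact Real.log_le_self hr0.le
    have k3 : r ^ (-u) ≤ 1 := Real.rpow_le_one_of_one_le_of_nonpos h (by linarith)
    have : 0 < δ ^ (-a) * (1/δ) * (1 + δ ^ (-c)) := by positivity
    calc r ^ (-a) * |log r| * (1 + r ^ (-u)) ≤ r ^ (-1:ℝ) * r * (1 + 1) := by gcongr
      _ = 2 := by rw [Real.rpow_neg_one]; field_simp; norm_num
      _ ≤ _ := by linarith
  · have k1 : r ^ (-a) ≤ δ ^ (-a) := Real.rpow_le_rpow_of_nonpos hδ hr (by linarith)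
    have k2 : |log r| ≤ 1/δ := by
      rw [abs_of_nonpos (Real.log_nonpos hr0.le h), ← Real.log_inv]
      refine (Real.log_le_self (by positivity)).trans ?_
      rw [← one_div]
      gcongr
    have k3 : r ^ (-u) ≤ δ ^ (-c) := by
      refine (Real.rpow_le_rpow_of_nonpos hδ hr (by linarith)).trans ?_
      exact Real.rpow_le_rpow_of_exponent_ge hδ (hr.trans h) (by linarith)
    calc r ^ (-a) * |log r| * (1 + r ^ (-u)) ≤ δ ^ (-a) * (1/δ) * (1 + δ ^ (-c)) := by gcongr
      _ ≤ _ := by linarith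

lemma contG (c : ℝ) (F : ℝ → ℝ)
    (hcont : ContinuousOn F (Icc 0 c)) (t : ℝ) (ht : 0 < t) :
    ContinuousOn (fun p => exp (-p) * (F (t * p) / F t)) (Ioc 0 (c / t)) := by
  have h : ContinuousOn (fun p => F (t * p)) (Ioc 0 (c / t)) := by
    refine hcont.comp (by fun_prop) ?_
    intro p hp
    have := hp.2
    rw [le_div_iff₀ ht] at this
    exact ⟨mul_nonneg ht.le hp.1.le, by linarith⟩
  exact ContinuousOn.mul (by fun_prop) (h.div_const _)

lemma bdG (c : ℝ) (F : ℝ → ℝ)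
    (hnn : ∀ q ∈ Icc 0 c, 0 ≤ F q)
    (C T : ℝ) 
    (hP : ∀ t ∈ Ioc 0 T, 0 < F t ∧ ∀ p, 0 < p → t * p ≤ c → F (t * p) ≤ C * exp (p / 2) * F t)
    (t : ℝ) (ht : t ∈ Ioc 0 T) (p : ℝ) (hp' : p ∈ Ioc 0 (c / t)) :
    t * p ≤ c ∧ 0 ≤ exp (-p) * (F (t * p) / F t) ∧
      exp (-p) * (F (t * p) / F t) ≤ C * exp (-(1/2) * p) := by
  have h1 : t * p ≤ c := by have := hp'.2; rw [le_div_iff₀ ht.1] at this; linarith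
  obtain ⟨h2, h3⟩ := hP t ht
  have h4 := hnn (t * p) ⟨mul_nonneg ht.1.le hp'.1.le, h1⟩
  refine ⟨h1, by positivity, ?_⟩
  have h5 : F (t * p) / F t ≤ C * exp (p / 2) := by
    rw [div_le_iff₀ h2]; exact h3 p hp'.1 h1
  calc _ ≤ exp (-p) * (C * exp (p / 2)) := by gcongr
    _ = C * (exp (-p) * exp (p/2)) := by ring
    _ = _ := by rw [← Real.exp_add]; ring_nf

lemma limJ (c β : ℝ) (hc : 0 < c) (hβ : 0 < β) (F : ℝ → ℝ)
    (hcont : ContinuousOn F (Icc 0 c)) (hnn : ∀ q ∈ Icc 0 c, 0 ≤ F q)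
    (C T : ℝ) (hC : 0 < C) (hT : 0 < T)
    (hP : ∀ t ∈ Ioc 0 T, 0 < F t ∧ ∀ p, 0 < p → t * p ≤ c → F (t * p) ≤ C * exp (p / 2) * F t)
    (hreg : ∀ K : Set ℝ, K ⊆ Ioi 0 → IsCompact K →
      TendstoUniformlyOn (fun t p => F (t * p) / F t) (fun p => p ^ β)
        (nhdsWithin 0 (Ioi 0)) K) :
    Tendsto (fun t => ∫ p in Ioc 0 (c / t), exp (-p) * (F (t * p) / F t))
      (nhdsWithin 0 (Ioi 0)) (nhds (Real.Gamma (β + 1))) := by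
  rw [Real.Gamma_eq_integral (by linarith)]
  have hev : ∀ᶠ t in nhdsWithin (0:ℝ) (Ioi 0), t ∈ Ioc 0 T := Ioc_mem_nhdsGT hT
  have heq : ∀ t, (∫ p in Ioc 0 (c / t), exp (-p) * (F (t * p) / F t)) =
      ∫ p in Ioi 0, (Ioc 0 (c / t)).indicator (fun p => exp (-p) * (F (t * p) / F t)) p := by
    intro t
    rw [setIntegral_indicator measurableSet_Ioc, Set.inter_eq_right.2 Ioc_subset_Ioi_self]
  simp_rw [heq]
  refine tendsto_integral_filter_of_dominated_convergence (fun p => C * exp (-(1/2) * p)) ?_ ?_ ?_ ?_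
  · filter_upwards [hev] with t ht
    refine AEStronglyMeasurable.restrict ?_
    rw [aestronglyMeasurable_indicator_iff measurableSet_Ioc]
    exact (contG c F hcont t ht.1).aestronglyMeasurable measurableSet_Ioc
  · filter_upwards [hev] with t ht
    filter_upwards [ae_restrict_mem measurableSet_Ioi] with p hp
    by_cases hp' : p ∈ Ioc 0 (c / t)
    · rw [indicator_of_mem hp']
      obtain ⟨_, h1, h2⟩ := bdG c F hnn C T hP t ht p hp'
      rwa [Real.norm_of_nonneg h1]
    · rw [indicator_of_notMem hp', norm_zero]; positivity
  · exact (exp_neg_integrableOn_Ioi 0 (by norm_num : (0:ℝ) < 1/2)).const_mul C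
  · filter_upwards [ae_restrict_mem measurableSet_Ioi] with p hp
    have hp0 : 0 < p := hp
    have h1 := (hreg {p} (by simpa using hp0) isCompact_singleton).tendsto_at (mem_singleton p)
    have h2 := h1.const_mul (exp (-p))
    rw [add_sub_cancel_right]
    refine h2.congr' ?_
    filter_upwards [Ioc_mem_nhdsGT (show 0 < c / p by positivity)] with t ht
    rw [indicator_of_mem]
    refine ⟨hp0, ?_⟩
    have := ht.2
    rw [le_div_iff₀ hp0] at this
    rw [le_div_iff₀ ht.1]; linarith

theorem stmt3 (α₀ : ℝ) (hα₀ : α₀ ∈ Ioo (0:ℝ) 2) (β : ℝ) (hβ : 0 < β)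
    (F' : ℝ → ℝ) (hFcont : ContinuousOn F' (Icc α₀ 2))
    (hFnonneg : ∀ q ∈ Icc α₀ 2, 0 ≤ F' q)
    (hFpos : ∃ ε > 0, ∀ t ∈ Ioo (0:ℝ) ε, 0 < F' (t + α₀))
    (hreg : ∀ K : Set ℝ, K ⊆ Ioi 0 → IsCompact K →
      TendstoUniformlyOn (fun t p => F' (t * p + α₀) / F' (t + α₀)) (fun p => p ^ β)
        (nhdsWithin 0 (Ioi 0)) K)
    (δ : ℝ) (hδ : 0 < δ) :
    ∀ ε > 0, ∃ N : ℕ, ∀ n ≥ N, ∀ y : ℝ, δ ≤ |y| →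
      |(∫ q in Ioc α₀ 2, |y| ^ (-1 - q) * (n : ℝ) ^ (1 - q / α₀) * F' q) /
          (F' (α₀ / Real.log n + α₀) * (α₀ / Real.log n) * Real.Gamma (β + 1)) -
        |y| ^ (-1 - α₀)| < ε := by
  intro ε hε
  obtain ⟨hα, hα2⟩ := hα₀
  set c : ℝ := 2 - α₀ with hcdef
  have hc : 0 < c := by linarith
  set F : ℝ → ℝ := fun t => F' (t + α₀) with hF
  have hcont : ContinuousOn F (Icc 0 c) := by
    refine hFcont.comp (by fun_prop) ?_
    intro x hx
    exact ⟨by linarith [hx.1], by linarith [hx.2]⟩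
  have hnn : ∀ q ∈ Icc 0 c, 0 ≤ F q := fun q hq =>
    hFnonneg _ ⟨by linarith [hq.1], by linarith [hq.2]⟩
  obtain ⟨C, T, hC, hT, hP⟩ := potter c β hc hβ F hcont hnn hFpos hreg
  have hJ := limJ c β hc hβ F hcont hnn C T hC hT hP hreg
  obtain ⟨L, hL, hlip⟩ := lip c (1 + α₀) δ (by linarith) hδ
  set Γ := Real.Gamma (β + 1) with hΓ
  have hΓ0 : 0 < Γ := Real.Gamma_pos_of_pos (by linarith)
  set I : ℝ := ∫ p in Ioi (0:ℝ), exp (-(1/4) * p) with hI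
  have hIint := exp_neg_integrableOn_Ioi 0 (by norm_num : (0:ℝ) < 1/4)
  have hI2 := exp_neg_integrableOn_Ioi 0 (by norm_num : (0:ℝ) < 1/2)
  -- the error bound tends to zero
  have herr : Tendsto (fun t => (L * 4 * C * I * t + δ ^ (-1 - α₀) *
      |(∫ p in Ioc 0 (c / t), exp (-p) * (F (t * p) / F t)) - Γ|) / Γ)
      (nhdsWithin 0 (Ioi 0)) (nhds 0) := by
    have h1 : Tendsto (fun t : ℝ => t) (nhdsWithin 0 (Ioi 0)) (nhds 0) := nhdsWithin_le_nhds
    have h2 := (((h1.const_mul (L * 4 * C * I)).add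
      ((hJ.sub_const Γ).abs.const_mul (δ ^ (-1 - α₀)))).div_const Γ)
    simpa using h2
  have htn : Tendsto (fun n : ℕ => α₀ / Real.log n) atTop (nhdsWithin 0 (Ioi 0)) := by
    have hl : Tendsto (fun n : ℕ => Real.log n) atTop atTop :=
      Real.tendsto_log_atTop.comp tendsto_natCast_atTop_atTop
    refine tendsto_nhdsWithin_iff.2 ⟨hl.const_div_atTop α₀, ?_⟩
    filter_upwards [hl.eventually_gt_atTop 0] with n hn
    exact div_pos hα hn
  have hev := htn.eventually ((herr.eventually (gt_mem_nhds hε)).and (Ioc_mem_nhdsGT hT))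
  obtain ⟨N, hN⟩ := eventually_atTop.1 (hev.and (eventually_ge_atTop 2))
  refine ⟨N, fun n hn y hy => ?_⟩
  obtain ⟨⟨hlt, ht⟩, hn2⟩ := hN n hn
  refine lt_of_le_of_lt ?_ hlt
  clear hlt hev htn herr hN hn
  have hn0 : (0:ℝ) < n := by positivity
  have hlog : 0 < Real.log n := Real.log_pos (by exact_mod_cast hn2)
  set t : ℝ := α₀ / Real.log n with htdef
  have ht0 : 0 < t := ht.1
  obtain ⟨hFt, -⟩ := hP t ht
  set r := |y| with hr
  have hr0 : 0 < r := by linarith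
  set G : ℝ → ℝ := fun p => exp (-p) * (F (t * p) / F t) with hG
  have hbd := bdG c F hnn C T hP t ht
  have hct : 0 ≤ c / t := by positivity
  -- change of variables
  have hcv : (∫ q in Ioc α₀ 2, r ^ (-1 - q) * (n : ℝ) ^ (1 - q / α₀) * F' q) =
      t * (F t * ∫ p in Ioc 0 (c / t), r ^ (-(1 + α₀) - t * p) * G p) := by
    rw [← intervalIntegral.integral_of_le hα2.le, ← intervalIntegral.integral_of_le hct]
    have h1 := intervalIntegral.smul_integral_comp_mul_add (a := 0) (b := c / t)
      (fun q => r ^ (-1 - q) * (n : ℝ) ^ (1 - q / α₀) * F' q) t α₀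
    rw [show t * 0 + α₀ = α₀ by ring,
      show t * (c / t) + α₀ = 2 by rw [mul_div_cancel₀ _ ht0.ne']; linarith] at h1
    rw [← h1, smul_eq_mul, ← intervalIntegral.integral_const_mul (F t)]
    congr 1
    refine intervalIntegral.integral_congr fun p _ => ?_
    have e1 : (n : ℝ) ^ (1 - (t * p + α₀) / α₀) = exp (-p) := by
      rw [Real.rpow_def_of_pos hn0]
      congr 1
      rw [htdef]
      field_simp
      ring
    have e2 : -1 - (t * p + α₀) = -(1 + α₀) - t * p := by ring
    simp only [e1, e2, hG]
    change _ * F (t * p) = _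
    field_simp
  have hGcont := contG c F hcont t ht0
  have hGint : IntegrableOn G (Ioc 0 (c / t)) := by
    refine Integrable.mono' ((hI2.mono_set Ioc_subset_Ioi_self).const_mul C)
      (hGcont.aestronglyMeasurable measurableSet_Ioc) ?_
    filter_upwards [ae_restrict_mem measurableSet_Ioc] with p hp
    rw [Real.norm_of_nonneg (hbd p hp).2.1]
    exact (hbd p hp).2.2
  set D : ℝ → ℝ := fun p => (r ^ (-(1 + α₀) - t * p) - r ^ (-(1 + α₀))) * G p with hD
  have hDbd : ∀ p ∈ Ioc 0 (c / t), ‖D p‖ ≤ L * 4 * C * t * exp (-(1/4) * p) := by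
    intro p hp
    obtain ⟨b1, b2, b3⟩ := hbd p hp
    have hp0 := hp.1
    have b4 := hlip r hy (t * p) (by positivity) b1
    have b5 : p ≤ 4 * exp (1/4 * p) := by
      have := Real.add_one_le_exp (1/4 * p)
      linarith
    rw [Real.norm_eq_abs, hD, abs_mul, abs_of_nonneg b2]
    calc _ ≤ L * (t * p) * (C * exp (-(1/2) * p)) := by gcongr
      _ ≤ L * (t * (4 * exp (1/4 * p))) * (C * exp (-(1/2) * p)) := by gcongr
      _ = L * 4 * C * t * (exp (1/4 * p) * exp (-(1/2) * p)) := by ring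
      _ = _ := by rw [← Real.exp_add]; ring_nf
  have hDdom : IntegrableOn (fun p => L * 4 * C * t * exp (-(1/4) * p)) (Ioi 0) :=
    hIint.const_mul _
  have hDint : IntegrableOn D (Ioc 0 (c / t)) := by
    refine Integrable.mono' (hDdom.mono_set Ioc_subset_Ioi_self) ?_ ?_
    · refine ContinuousOn.aestronglyMeasurable ?_ measurableSet_Ioc
      refine ContinuousOn.mul ?_ hGcont
      refine Continuous.continuousOn ?_
      refine Continuous.sub ?_ continuous_const
      exact Continuous.rpow continuous_const (by fun_prop) (fun _ => Or.inl hr0.ne')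
    · filter_upwards [ae_restrict_mem measurableSet_Ioc] with p hp
      exact hDbd p hp
  have hDI : |∫ p in Ioc 0 (c / t), D p| ≤ L * 4 * C * I * t := by
    calc |∫ p in Ioc 0 (c / t), D p| ≤ ∫ p in Ioc 0 (c / t), L * 4 * C * t * exp (-(1/4) * p) := by
          rw [← Real.norm_eq_abs]
          refine norm_integral_le_of_norm_le (hDdom.mono_set Ioc_subset_Ioi_self) ?_
          filter_upwards [ae_restrict_mem measurableSet_Ioc] with p hp
          exact hDbd p hp
      _ ≤ ∫ p in Ioi 0, L * 4 * C * t * exp (-(1/4) * p) := by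
          refine setIntegral_mono_set hDdom ?_ (LE.le.eventuallyLE Ioc_subset_Ioi_self)
          exact Eventually.of_forall fun p => by simp only [Pi.zero_apply]; positivity
      _ = _ := by rw [integral_const_mul, ← hI]; ring
  have hsplit : (∫ p in Ioc 0 (c / t), r ^ (-(1 + α₀) - t * p) * G p) =
      (∫ p in Ioc 0 (c / t), D p) + r ^ (-(1 + α₀)) * ∫ p in Ioc 0 (c / t), G p := by
    rw [← integral_const_mul, ← integral_add hDint (hGint.const_mul _)]
    refine integral_congr_ae (Eventually.of_forall fun p => ?_)
    simp only [hD]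
    ring
  rw [hcv, hsplit]
  change |_ / (F t * t * Γ) - _| ≤ _
  have hexp : -1 - α₀ = -(1 + α₀) := by ring
  rw [hexp]
  set A := ∫ p in Ioc 0 (c / t), D p
  set J := ∫ p in Ioc 0 (c / t), G p
  have hfin : t * (F t * (A + r ^ (-(1 + α₀)) * J)) / (F t * t * Γ) - r ^ (-(1 + α₀)) =
      (A + r ^ (-(1 + α₀)) * (J - Γ)) / Γ := by
    field_simp
    ring
  rw [hfin, abs_div, abs_of_pos hΓ0]
  gcongr
  refine (abs_add_le _ _).trans ?_
  rw [abs_mul, abs_of_pos (by positivity : 0 < r ^ (-(1 + α₀)))]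
  have hrδ : r ^ (-(1 + α₀)) ≤ δ ^ (-(1 + α₀)) :=
    Real.rpow_le_rpow_of_nonpos hδ hy (by linarith)
  gcongr
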